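/- arXiv:2203.07723 — 8 statements merged into one kernel-verified Lean document; each statement's English description precedes it below -/
import Mathlib

section
/- Let (X₁, μ₁) and (X₂, μ₂) be measure spaces, let g₁ : X₁ → [0,∞] and g₂ : X₂ → [0,∞] be measurable, and let r₀ > 0. If μ₁({g₁ ≥ r⁻¹}) ≥ μ₂({g₂ ≥ r⁻¹}) for every r ∈ (0, r₀], then ∫_{{g₁ ≥ r₀⁻¹}} g₁ dμ₁ ≥ ∫_{{g₂ ≥ r₀⁻¹}} g₂ dμ₂. -/
open MeasureTheory Set
open scoped ENNReal

/-- The layer cake formula for a truncated `ℝ≥0∞`-valued function. -/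
theorem lintegral_min_natCast_eq_lintegral_meas_le {α : Type*} [MeasurableSpace α]
    (μ : Measure α) {f : α → ℝ≥0∞} (hf : Measurable f) (n : ℕ) :
    ∫⁻ x, min (f x) n ∂μ = ∫⁻ t in Ioi (0 : ℝ), μ {x | ENNReal.ofReal t ≤ min (f x) n} := by
  have hfin (x : α) : min (f x) n ≠ ∞ :=
    ((min_le_right _ _).trans_lt (ENNReal.natCast_lt_top n)).ne
  have key := lintegral_eq_lintegral_meas_le μ (f := fun x ↦ (min (f x) n).toReal)
    (.of_forall fun _ ↦ ENNReal.toReal_nonneg)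
    (hf.min measurable_const).ennreal_toReal.aemeasurable
  simpa only [ENNReal.ofReal_toReal (hfin _), ← ENNReal.ofReal_le_iff_le_toReal (hfin _)]
    using key

/-- Pointwise comparison of the measures of superlevel sets implies comparison of integrals. -/
theorem lintegral_le_lintegral_of_meas_superlevel_le {α β : Type*} [MeasurableSpace α]
    [MeasurableSpace β] {μ : Measure α} {ν : Measure β} {f : α → ℝ≥0∞} {g : β → ℝ≥0∞}
    (hf : Measurable f) (hg : Measurable g)
    (h : ∀ t : ℝ, 0 < t → μ {x | ENNReal.ofReal t ≤ f x} ≤ ν {x | ENNReal.ofReal t ≤ g x}) :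
    ∫⁻ x, f x ∂μ ≤ ∫⁻ x, g x ∂ν := by
  have iSup_min (a : ℝ≥0∞) : ⨆ n : ℕ, min a n = a := by
    rw [← inf_iSup_eq, ENNReal.iSup_natCast, inf_top_eq]
  calc
    ∫⁻ x, f x ∂μ = ∫⁻ x, ⨆ n : ℕ, min (f x) n ∂μ := by simp only [iSup_min]
    _ = ⨆ n : ℕ, ∫⁻ x, min (f x) n ∂μ :=
      lintegral_iSup (fun n ↦ hf.min measurable_const)
        fun m n hmn x ↦ min_le_min_left _ (Nat.cast_le.2 hmn)
    _ ≤ ∫⁻ x, g x ∂ν := iSup_le fun n ↦ ?_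
  calc
    ∫⁻ x, min (f x) n ∂μ = ∫⁻ t in Ioi (0 : ℝ), μ {x | ENNReal.ofReal t ≤ min (f x) n} :=
      lintegral_min_natCast_eq_lintegral_meas_le μ hf n
    _ ≤ ∫⁻ t in Ioi (0 : ℝ), ν {x | ENNReal.ofReal t ≤ min (g x) n} := by
      refine setLIntegral_mono' measurableSet_Ioi fun t ht ↦ ?_
      by_cases htn : ENNReal.ofReal t ≤ n
      · simpa [le_min_iff, htn] using h t ht
      · simp [htn]
    _ = ∫⁻ x, min (g x) n ∂ν := (lintegral_min_natCast_eq_lintegral_meas_le ν hg n).symm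
    _ ≤ ∫⁻ x, g x ∂ν := lintegral_mono fun x ↦ min_le_left _ _

/-- Superlevel sets of a function restricted to one of its own superlevel sets. -/
theorem setOf_ofReal_le_indicator_superlevel {α : Type*} (f : α → ℝ≥0∞) (c : ℝ) {t : ℝ}
    (ht : 0 < t) :
    {x | ENNReal.ofReal t ≤ {x | ENNReal.ofReal c ≤ f x}.indicator f x} =
      {x | ENNReal.ofReal (max t c) ≤ f x} := by
  ext x
  by_cases hx : ENNReal.ofReal c ≤ f x <;> simp [indicator, hx, ht, ENNReal.ofReal_max]

/-- (Comparison of superlevel-set measures.) If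
`μ₁({g₁ ≥ r⁻¹}) ≥ μ₂({g₂ ≥ r⁻¹})` for every `r ∈ (0, r₀]`, then
`∫_{{g₁ ≥ r₀⁻¹}} g₁ dμ₁ ≥ ∫_{{g₂ ≥ r₀⁻¹}} g₂ dμ₂`. -/
theorem stmt2 {X₁ X₂ : Type*} [MeasurableSpace X₁] [MeasurableSpace X₂]
    (μ₁ : Measure X₁) (μ₂ : Measure X₂)
    (g₁ : X₁ → ℝ≥0∞) (g₂ : X₂ → ℝ≥0∞)
    (hg₁ : Measurable g₁) (hg₂ : Measurable g₂)
    (r₀ : ℝ) (hr₀ : 0 < r₀)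
    (h : ∀ r : ℝ, r ∈ Set.Ioc 0 r₀ →
      μ₂ {x | ENNReal.ofReal r⁻¹ ≤ g₂ x} ≤ μ₁ {x | ENNReal.ofReal r⁻¹ ≤ g₁ x}) :
    ∫⁻ x in {x | ENNReal.ofReal r₀⁻¹ ≤ g₂ x}, g₂ x ∂μ₂ ≤
      ∫⁻ x in {x | ENNReal.ofReal r₀⁻¹ ≤ g₁ x}, g₁ x ∂μ₁ := by
  have hs₁ : MeasurableSet {x | ENNReal.ofReal r₀⁻¹ ≤ g₁ x} :=
    measurableSet_le measurable_const hg₁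
  have hs₂ : MeasurableSet {x | ENNReal.ofReal r₀⁻¹ ≤ g₂ x} :=
    measurableSet_le measurable_const hg₂
  rw [← lintegral_indicator hs₁, ← lintegral_indicator hs₂]
  refine lintegral_le_lintegral_of_meas_superlevel_le (hg₂.indicator hs₂) (hg₁.indicator hs₁)
    fun t ht ↦ ?_
  rw [setOf_ofReal_le_indicator_superlevel g₁ _ ht, setOf_ofReal_le_indicator_superlevel g₂ _ ht]
  have hmax : 0 < max t r₀⁻¹ := lt_max_of_lt_left ht
  simpa only [inv_inv] using
    h (max t r₀⁻¹)⁻¹ ⟨inv_pos.2 hmax, inv_le_of_inv_le₀ hr₀ (le_max_right _ _)⟩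
end

section
/- Let a : ℝ → (0,∞) be a measurable function such that t ↦ a(t)eᵗ is nondecreasing on (T₀, ∞) for some T₀ ∈ ℝ, and such that ∫_s^∞ a(t) dt = ∞ for every s ∈ ℝ. Then there exist a measurable function ã : ℝ → (0,∞) and T₁ ∈ ℝ such that: (1) ã(t) ≤ a(t) for every t > T₁; (2) t ↦ ã(t)eᵗ is strictly increasing and continuous on (T₁, ∞); (3) ∫_s^∞ ã(t) dt = ∞ for every s ∈ ℝ. -/
open MeasureTheory Set
open scoped ENNReal

lemma Monotone.le_integral_sub_one {B : ℝ → ℝ} (hB : Monotone B) (t : ℝ) :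
    B (t - 1) ≤ ∫ s in (t - 1)..t, B s := by
  have h := intervalIntegral.integral_mono_on (μ := volume) (a := t - 1) (b := t)
    (f := fun _ => B (t - 1)) (g := B) (by linarith) intervalIntegrable_const
    hB.intervalIntegrable (fun x hx => hB hx.1)
  simpa using h

lemma Monotone.integral_sub_one_le {B : ℝ → ℝ} (hB : Monotone B) (t : ℝ) :
    ∫ s in (t - 1)..t, B s ≤ B t := by
  have h := intervalIntegral.integral_mono_on (μ := volume) (a := t - 1) (b := t)
    (f := B) (g := fun _ => B t) (by linarith) hB.intervalIntegrable
    intervalIntegrable_const (fun x hx => hB hx.2)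
  simpa using h

lemma Monotone.continuous_integral_sub_one {B : ℝ → ℝ} (hB : Monotone B) :
    Continuous fun t => ∫ s in (t - 1)..t, B s := by
  have hc : Continuous fun t => ∫ s in (0 : ℝ)..t, B s :=
    intervalIntegral.continuous_primitive (fun _ _ => hB.intervalIntegrable) 0
  have he : (fun t => ∫ s in (t - 1)..t, B s)
      = fun t => (∫ s in (0 : ℝ)..t, B s) - ∫ s in (0 : ℝ)..(t - 1), B s := by
    funext t
    exact (intervalIntegral.integral_interval_sub_left hB.intervalIntegrable
      hB.intervalIntegrable).symm
  rw [he]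
  exact hc.sub (hc.comp (continuous_id.sub continuous_const))

lemma Monotone.integral_sub_one {B : ℝ → ℝ} (hB : Monotone B) :
    Monotone fun t => ∫ s in (t - 1)..t, B s := by
  have he : ∀ t, ∫ s in (t - 1)..t, B s = ∫ u in (0 : ℝ)..1, B (u + (t - 1)) := by
    intro t
    rw [intervalIntegral.integral_comp_add_right]
    congr 1 <;> ring
  have hm : ∀ t, Monotone fun u => B (u + t) := fun t x y h => hB (by linarith)
  intro x y hxy
  simp only [he]
  exact intervalIntegral.integral_mono_on zero_le_one (hm _).intervalIntegrable
    (hm _).intervalIntegrable (fun u _ => hB (by linarith))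

/-- If `a : ℝ → (0,∞)` is measurable, `t ↦ a(t)eᵗ` is nondecreasing on
`(T₀, ∞)` and `a` is not integrable near `+∞`, then there are a measurable positive
function `a'` (the `ã` of the paper) and `T₁` such that `a' ≤ a` on `(T₁, ∞)`,
`t ↦ a'(t)eᵗ` is strictly increasing and continuous on `(T₁, ∞)`, and `a'` is not
integrable near `+∞`. -/
theorem stmt3 (a : ℝ → ℝ) (ha : Measurable a) (hpos : ∀ t, 0 < a t)
    (T₀ : ℝ) (hmono : MonotoneOn (fun t => a t * Real.exp t) (Set.Ioi T₀))
    (hint : ∀ s : ℝ, ∫⁻ t in Set.Ioi s, ENNReal.ofReal (a t) = ⊤) :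
    ∃ (a' : ℝ → ℝ) (T₁ : ℝ), Measurable a' ∧ (∀ t, 0 < a' t) ∧
      (∀ t, T₁ < t → a' t ≤ a t) ∧
      StrictMonoOn (fun t => a' t * Real.exp t) (Set.Ioi T₁) ∧
      ContinuousOn (fun t => a' t * Real.exp t) (Set.Ioi T₁) ∧
      (∀ s : ℝ, ∫⁻ t in Set.Ioi s, ENNReal.ofReal (a' t) = ⊤) := by
  set B : ℝ → ℝ := fun t => a (max t (T₀ + 1)) * Real.exp (max t (T₀ + 1)) with hBdef
  have hB : Monotone B := by
    intro x y hxy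
    have h : ∀ z : ℝ, max z (T₀ + 1) ∈ Ioi T₀ := fun z =>
      (lt_add_one T₀).trans_le (le_max_right _ _)
    exact hmono (h x) (h y) (max_le_max_right _ hxy)
  have hBpos : ∀ t, 0 < B t := fun t => mul_pos (hpos _) (Real.exp_pos _)
  have hBeq : ∀ t, T₀ + 1 ≤ t → B t = a t * Real.exp t := by
    intro t ht
    simp only [hBdef, max_eq_left ht]
  set F : ℝ → ℝ := fun t => ∫ s in (t - 1)..t, B s with hF
  have hFpos : ∀ t, 0 < F t := fun t => (hBpos _).trans_le (hB.le_integral_sub_one t)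
  have hFc : Continuous F := hB.continuous_integral_sub_one
  have hcancel : ∀ t, Real.exp (-t) * Real.exp t = 1 := fun t => by
    rw [← Real.exp_add]; simp
  have hprod : ∀ t, F t * Real.sigmoid t * Real.exp (-t) * Real.exp t
      = F t * Real.sigmoid t := fun t => by rw [mul_assoc, hcancel, mul_one]
  have hsc : Continuous Real.sigmoid := by fun_prop
  refine ⟨fun t => F t * Real.sigmoid t * Real.exp (-t), T₀ + 1, ?_, ?_, ?_, ?_, ?_, ?_⟩
  · exact Continuous.measurable (by fun_prop)
  · intro t
    exact mul_pos (mul_pos (hFpos t) (Real.sigmoid_pos t)) (Real.exp_pos _)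
  · intro t ht
    have h1 : F t ≤ a t * Real.exp t := (hB.integral_sub_one_le t).trans_eq (hBeq t ht.le)
    refine le_of_mul_le_mul_right ?_ (Real.exp_pos t)
    rw [hprod]
    exact (mul_le_of_le_one_right (hFpos t).le (Real.sigmoid_le_one t)).trans h1
  · intro x _ y _ hxy
    simp only [hprod]
    exact mul_lt_mul' (hB.integral_sub_one hxy.le) (Real.sigmoid_strictMono hxy)
      (Real.sigmoid_pos x).le (hFpos y)
  · simp only [hprod]
    fun_prop
  · intro s
    set S := max (max s 0) (T₀ + 2) with hS
    set c : ℝ := Real.exp (-1) / 2 with hc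
    have hcpos : 0 < c := by positivity
    have hshift : ∫⁻ t in Ioi S, ENNReal.ofReal (a (t - 1)) = ⊤ := by
      have h := (measurePreserving_sub_right volume (1 : ℝ)).setLIntegral_comp_preimage
        (measurableSet_Ioi (a := S - 1)) ha.ennreal_ofReal
      rw [hint] at h
      simpa using h
    rw [eq_top_iff]
    calc (⊤ : ℝ≥0∞) = ENNReal.ofReal c * ∫⁻ t in Ioi S, ENNReal.ofReal (a (t - 1)) := by
          rw [hshift, ENNReal.mul_top (by simpa using hcpos)]
      _ = ∫⁻ t in Ioi S, ENNReal.ofReal c * ENNReal.ofReal (a (t - 1)) :=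
          (lintegral_const_mul' _ _ ENNReal.ofReal_ne_top).symm
      _ ≤ ∫⁻ t in Ioi S, ENNReal.ofReal (F t * Real.sigmoid t * Real.exp (-t)) := by
          refine setLIntegral_mono' measurableSet_Ioi fun t ht => ?_
          rw [← ENNReal.ofReal_mul hcpos.le]
          refine ENNReal.ofReal_le_ofReal ?_
          obtain ⟨h12, h3⟩ := max_lt_iff.1 (mem_Ioi.1 ht)
          obtain ⟨-, h2⟩ := max_lt_iff.1 h12
          have h4 : a (t - 1) * Real.exp (t - 1) ≤ F t :=
            (hBeq (t - 1) (by linarith)).symm.trans_le (hB.le_integral_sub_one t)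
          have h5 : 1 / 2 ≤ Real.sigmoid t := by
            have := Real.sigmoid_strictMono h2
            rw [Real.sigmoid_zero] at this
            linarith
          have h6 : c * a (t - 1)
              = a (t - 1) * Real.exp (t - 1) * (1 / 2) * Real.exp (-t) := by
            have : Real.exp (-1) = Real.exp (t - 1) * Real.exp (-t) := by
              rw [← Real.exp_add]; ring_nf
            rw [hc, this]; ring
          rw [h6]
          have := hFpos t
          gcongr
      _ ≤ ∫⁻ t in Ioi s, ENNReal.ofReal (F t * Real.sigmoid t * Real.exp (-t)) :=
          lintegral_mono_set (Ioi_subset_Ioi ((le_max_left _ _).trans (le_max_left _ _)))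
end

section
/- Let (X, μ) be a measure space, let Ψ : X → ℝ be measurable with Ψ(x) < 0 for all x ∈ X, let g : X → [0,∞] be measurable, let t > 0 and C ∈ [0,∞). Assume that for every l ∈ [0, t), ∫_{{−t ≤ Ψ < −l}} g dμ ≥ ((e^{−l} − e^{−t})/(1 − e^{−t}))·C. Then ∫_{{−t ≤ Ψ < 0}} g·e^{−Ψ} dμ ≥ (t/(1 − e^{−t}))·C. -/
open MeasureTheory Set
open scoped ENNReal

/-- Layer-cake formula for the exponential of a nonnegative function. -/
lemma lintegral_exp_eq_measure_univ_add {X : Type*} [MeasurableSpace X] (ν : Measure X)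
    {f : X → ℝ} (hf : Measurable f) (hf0 : ∀ x, 0 ≤ f x) :
    ∫⁻ x, ENNReal.ofReal (Real.exp (f x)) ∂ν =
      ν univ + ∫⁻ s in Ioi (0 : ℝ), ν {x | s < f x} * ENNReal.ofReal (Real.exp s) := by
  rw [← lintegral_comp_eq_lintegral_meas_lt_mul ν (ae_of_all _ hf0) hf.aemeasurable
    (fun s _ => Real.continuous_exp.intervalIntegrable _ _)
    (ae_of_all _ fun s => (Real.exp_pos s).le), ← lintegral_one,
    ← lintegral_add_left measurable_const]
  refine lintegral_congr fun x => ?_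
  rw [integral_exp, Real.exp_zero, ← ENNReal.ofReal_one, ← ENNReal.ofReal_add zero_le_one]
  · congr 1
    ring
  · linarith [Real.one_le_exp (hf0 x)]

lemma integral_exp_mul_exp_neg_sub_div (t c d : ℝ) :
    ∫ s in (0 : ℝ)..t, (Real.exp (-s) - c) / d * Real.exp s =
      (t - c * (Real.exp t - 1)) / d := by
  have key (s : ℝ) : (Real.exp (-s) - c) / d * Real.exp s = (1 - c * Real.exp s) / d := by
    have : Real.exp (-s) * Real.exp s = 1 := by rw [← Real.exp_add]; simp
    rw [div_mul_eq_mul_div, sub_mul, this]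
  simp_rw [key]
  rw [intervalIntegral.integral_div, intervalIntegral.integral_sub (by simp)
    ((Real.continuous_exp.const_mul c).intervalIntegrable _ _)]
  simp

/-- (Optimal support function, measure-theoretic core.) If
`∫_{{−t ≤ Ψ < −l}} g dμ ≥ ((e^{−l} − e^{−t})/(1 − e^{−t}))·C` for every `l ∈ [0, t)`,
then `∫_{{−t ≤ Ψ < 0}} g·e^{−Ψ} dμ ≥ (t/(1 − e^{−t}))·C`. -/
theorem stmt5 {X : Type*} [MeasurableSpace X] (μ : Measure X)
    (Ψ : X → ℝ) (hΨ : Measurable Ψ) (hΨneg : ∀ x, Ψ x < 0)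
    (g : X → ℝ≥0∞) (hg : Measurable g)
    (t : ℝ) (ht : 0 < t) (C : ℝ≥0∞) (hC : C ≠ ⊤)
    (h : ∀ l : ℝ, 0 ≤ l → l < t →
      ENNReal.ofReal ((Real.exp (-l) - Real.exp (-t)) / (1 - Real.exp (-t))) * C ≤
        ∫⁻ x in {x | -t ≤ Ψ x ∧ Ψ x < -l}, g x ∂μ) :
    ENNReal.ofReal (t / (1 - Real.exp (-t))) * C ≤
      ∫⁻ x in {x | -t ≤ Ψ x ∧ Ψ x < 0}, g x * ENNReal.ofReal (Real.exp (-Ψ x)) ∂μ := by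
  have hd : 0 < 1 - Real.exp (-t) := by
    have : Real.exp (-t) < 1 := by simpa using ht
    linarith
  set S := {x | -t ≤ Ψ x ∧ Ψ x < 0} with hS
  set ν := (μ.restrict S).withDensity g with hν
  have hνl (l : ℝ) (hl : 0 ≤ l) :
      ν {x | l < -Ψ x} = ∫⁻ x in {x | -t ≤ Ψ x ∧ Ψ x < -l}, g x ∂μ := by
    have hm : MeasurableSet {x | l < -Ψ x} := measurableSet_lt measurable_const hΨ.neg
    rw [hν, withDensity_apply _ hm, Measure.restrict_restrict hm]
    congr 2
    ext x
    simp only [hS, mem_inter_iff, mem_ofPred_eq]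
    constructor
    · rintro ⟨h1, h2, -⟩
      exact ⟨h2, by linarith⟩
    · rintro ⟨h1, h2⟩
      exact ⟨by linarith, h1, hΨneg x⟩
  have hexp : ∫⁻ x in S, g x * ENNReal.ofReal (Real.exp (-Ψ x)) ∂μ =
      ∫⁻ x, ENNReal.ofReal (Real.exp (-Ψ x)) ∂ν := by
    rw [hν, lintegral_withDensity_eq_lintegral_mul _ hg (by fun_prop)]
    rfl
  have hC1 : C ≤ ν univ := by
    have h0 := h 0 le_rfl ht
    rw [← hνl 0 le_rfl, neg_zero, Real.exp_zero, div_self hd.ne', ENNReal.ofReal_one,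
      one_mul] at h0
    exact h0.trans (measure_mono (subset_univ _))
  set w : ℝ → ℝ := fun s =>
    (Real.exp (-s) - Real.exp (-t)) / (1 - Real.exp (-t)) * Real.exp s with hw
  have hwc : Continuous w := by fun_prop
  have hw0 (s : ℝ) (hs : s ≤ t) :
      0 ≤ (Real.exp (-s) - Real.exp (-t)) / (1 - Real.exp (-t)) :=
    div_nonneg (sub_nonneg.2 (Real.exp_le_exp.2 (by linarith))) hd.le
  have hwint : ∫⁻ s in Ioo 0 t, ENNReal.ofReal (w s) =
      ENNReal.ofReal (t / (1 - Real.exp (-t)) - 1) := by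
    rw [← ofReal_integral_eq_lintegral_ofReal
      ((hwc.integrableOn_Icc (a := 0) (b := t)).mono_set Ioo_subset_Icc_self)
      ((ae_restrict_iff' measurableSet_Ioo).2 <| ae_of_all _ fun s hs =>
        mul_nonneg (hw0 s hs.2.le) (Real.exp_pos s).le),
      ← integral_Ioc_eq_integral_Ioo, ← intervalIntegral.integral_of_le ht.le,
      integral_exp_mul_exp_neg_sub_div]
    have hone : Real.exp (-t) * Real.exp t = 1 := by rw [← Real.exp_add]; simp
    rw [mul_sub, hone, mul_one]
    congr 1
    field_simp
  have hlow : ENNReal.ofReal (t / (1 - Real.exp (-t)) - 1) * C ≤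
      ∫⁻ s in Ioi (0 : ℝ), ν {x | s < -Ψ x} * ENNReal.ofReal (Real.exp s) := by
    rw [← hwint, ← lintegral_mul_const _ (by fun_prop)]
    refine (setLIntegral_mono' measurableSet_Ioo fun s hs => ?_).trans
      (lintegral_mono_set Ioo_subset_Ioi_self)
    rw [hνl s hs.1.le, hw, ENNReal.ofReal_mul (hw0 s hs.2.le), mul_right_comm]
    gcongr
    exact h s hs.1.le hs.2
  have ht1 : 0 ≤ t / (1 - Real.exp (-t)) - 1 := by
    rw [sub_nonneg, one_le_div hd]
    linarith [Real.add_one_le_exp (-t)]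
  rw [hexp, lintegral_exp_eq_measure_univ_add ν (f := fun x => -Ψ x) hΨ.neg
    fun x => (neg_pos.2 (hΨneg x)).le]
  calc ENNReal.ofReal (t / (1 - Real.exp (-t))) * C
      = C + ENNReal.ofReal (t / (1 - Real.exp (-t)) - 1) * C := by
        rw [← one_add_mul, ← ENNReal.ofReal_one, ← ENNReal.ofReal_add zero_le_one ht1,
          add_sub_cancel]
    _ ≤ _ := add_le_add hC1 hlow
end

section
/- Let (X, ν) be a measure space, let Φ : X → [−∞, ∞) be measurable, and let t₀ ∈ ℝ, C > 0. Assume ν({Φ < −s}) ≥ C·e^{−s} for every s ≥ t₀. Then for every t ≥ t₀, ∫_{{Φ < −t}} e^{−Φ} dν = ∞. -/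
open MeasureTheory Set
open scoped ENNReal

/-- (Layer-cake divergence.) Let `Φ : X → [−∞, ∞)` be measurable
with `ν({Φ < −s}) ≥ C·e^{−s}` for every `s ≥ t₀`. Then `∫_{{Φ < −t}} e^{−Φ} dν = ∞`
for every `t ≥ t₀`, where `e^{−Φ} = +∞` on `{Φ = −∞}`. -/
theorem stmt7 {X : Type*} [MeasurableSpace X] (ν : Measure X)
    (Φ : X → EReal) (hΦ : Measurable Φ) (hΦtop : ∀ x, Φ x < ⊤)
    (t₀ : ℝ) (C : ℝ) (hC : 0 < C)
    (h : ∀ s : ℝ, t₀ ≤ s →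
      ENNReal.ofReal (C * Real.exp (-s)) ≤ ν {x | Φ x < ((-s : ℝ) : EReal)}) :
    ∀ t : ℝ, t₀ ≤ t →
      ∫⁻ x in {x | Φ x < ((-t : ℝ) : EReal)}, EReal.exp (-(Φ x)) ∂ν = ⊤ := by
  intro t ht
  have hexp : Measurable fun x => EReal.exp (-(Φ x)) := by fun_prop
  have hmeas : ∀ s : ℝ, MeasurableSet {x | Φ x < ((-s : ℝ) : EReal)} := fun s =>
    measurableSet_lt hΦ measurable_const
  set μ := ν.withDensity fun x => EReal.exp (-(Φ x)) with hμ
  set A : ℕ → Set X := fun n => {x | Φ x < ((-(t + n) : ℝ) : EReal)} with hA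
  have hAmeas : ∀ n, MeasurableSet (A n) := fun n => hmeas _
  have hanti : Antitone A := by
    intro m n hmn x hx
    refine lt_of_lt_of_le (show Φ x < _ from hx) (EReal.coe_le_coe_iff.2 ?_)
    have : (m : ℝ) ≤ n := by exact_mod_cast hmn
    linarith
  have hlower : ∀ n, ENNReal.ofReal C ≤ μ (A n) := by
    intro n
    rw [hμ, withDensity_apply _ (hAmeas n)]
    calc ENNReal.ofReal C
        = EReal.exp ((t + n : ℝ) : EReal) * ENNReal.ofReal (C * Real.exp (-(t + n))) := by
          rw [EReal.exp_coe, ← ENNReal.ofReal_mul (Real.exp_pos _).le, mul_left_comm,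
            ← Real.exp_add, add_neg_cancel, Real.exp_zero, mul_one]
      _ ≤ EReal.exp ((t + n : ℝ) : EReal) * ν (A n) := by
          gcongr
          exact h _ (by linarith [n.cast_nonneg (α := ℝ)])
      _ = ∫⁻ _ in A n, EReal.exp ((t + n : ℝ) : EReal) ∂ν := (setLIntegral_const _ _).symm
      _ ≤ _ := by
          refine setLIntegral_mono hexp fun x hx => EReal.exp_monotone ?_
          have hx' : Φ x ≤ ((-(t + n) : ℝ) : EReal) := (show Φ x < _ from hx).le
          rw [EReal.coe_neg] at hx'
          exact EReal.le_neg_of_le_neg hx'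
  have hA0 : {x | Φ x < ((-t : ℝ) : EReal)} = A 0 := by simp [hA]
  rw [hA0, ← withDensity_apply _ (hAmeas 0), ← hμ]
  by_contra hfin
  have hinter : ENNReal.ofReal C ≤ μ (⋂ n, A n) :=
    ge_of_tendsto' (tendsto_measure_iInter_atTop
      (fun n => (hAmeas n).nullMeasurableSet) hanti ⟨0, hfin⟩) hlower
  have hbot : ∀ x ∈ ⋂ n, A n, Φ x = ⊥ := by
    intro x hx
    rw [EReal.eq_bot_iff_forall_lt]
    intro y
    obtain ⟨n, hn⟩ := exists_nat_ge (-y - t)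
    exact lt_of_lt_of_le (show Φ x < _ from mem_iInter.1 hx n)
      (EReal.coe_le_coe_iff.2 (by linarith))
  have hval : μ (⋂ n, A n) = ⊤ * ν (⋂ n, A n) := by
    rw [hμ, withDensity_apply _ (MeasurableSet.iInter hAmeas), ← setLIntegral_const]
    refine setLIntegral_congr_fun (MeasurableSet.iInter hAmeas) fun x hx => ?_
    simp [hbot x hx]
  have hpos : ν (⋂ n, A n) ≠ 0 := by
    intro h0
    rw [hval, h0, mul_zero] at hinter
    exact (ENNReal.ofReal_pos.2 hC).not_ge hinter
  refine hfin (top_le_iff.1 ?_)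
  rw [← ENNReal.top_mul hpos, ← hval]
  exact measure_mono (iInter_subset A 0)
end

section
/- Let δ > 0, T ∈ ℝ, and let c : [T, ∞) → (0, ∞) be a C^∞ function such that t ↦ c(t)e^{−t} is nonincreasing on [T, ∞). Define A(t) = (1/δ)·c(T)e^{−T} + ∫_T^t c(s)e^{−s} ds, u(t) = −log A(t), and s(t) = (∫_T^t A(s) ds + (1/δ²)·c(T)e^{−T}) / A(t). Then u and s are C^∞ on [T, ∞), and for every t ∈ (T, ∞) the following hold: (1) s′(t) − s(t)·u′(t) = 1; (2) u″(t)·s(t) − s″(t) > 0; (3) s(t) ≥ 1/δ; (4) (s(t) + s′(t)²/(u″(t)·s(t) − s″(t)))·e^{u(t) − t} = 1/c(t). -/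
open Set intervalIntegral
open scoped Topology

lemma hasDerivWithinAt_integral_Ici {f : ℝ → ℝ} {T t : ℝ} (hf : ContinuousOn f (Ici T))
    (ht : T ≤ t) : HasDerivWithinAt (fun t => ∫ x in T..t, f x) (f t) (Ici T) t := by
  have hg : Continuous fun x => f (max T x) :=
    hf.comp_continuous (by fun_prop) fun x => le_max_left T x
  have h := (hg.integral_hasStrictDerivAt T t).hasDerivAt.hasDerivWithinAt (s := Ici T)
  rw [max_eq_right ht] at h
  have heq : ∀ y ∈ Ici T, (∫ x in T..y, f x) = ∫ x in T..y, f (max T x) := by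
    intro y hy
    refine integral_congr fun x hx => ?_
    rw [uIcc_of_le hy] at hx
    simp only [max_eq_right hx.1]
  exact h.congr heq (heq t ht)

lemma contDiffOn_integral_Ici {f : ℝ → ℝ} {T : ℝ} (hf : ContDiffOn ℝ (⊤ : ℕ∞) f (Ici T)) :
    ContDiffOn ℝ (⊤ : ℕ∞) (fun t => ∫ x in T..t, f x) (Ici T) := by
  have hd := fun t (ht : t ∈ Ici T) => hasDerivWithinAt_integral_Ici hf.continuousOn ht
  rw [contDiffOn_infty_iff_derivWithin (uniqueDiffOn_Ici T)]
  exact ⟨fun t ht => (hd t ht).differentiableWithinAt,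
    hf.congr fun t ht => (hd t ht).derivWithin (uniqueDiffOn_Ici T t ht)⟩

/-- If `g` is nonincreasing, `A` a primitive of `g`, `B` a primitive of `A`, and `B g = A ^ 2` at
`T`, then `B g < A ^ 2` on `(T, ∞)`. -/
lemma mul_lt_sq_of_hasDerivWithinAt {A B g : ℝ → ℝ} {T t : ℝ} (ht : T < t)
    (hA : ∀ x ∈ Ici T, HasDerivWithinAt A (g x) (Ici T) x)
    (hB : ∀ x ∈ Ici T, HasDerivWithinAt B (A x) (Ici T) x)
    (hApos : ∀ x ∈ Ici T, 0 < A x) (hgpos : ∀ x ∈ Ici T, 0 < g x)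
    (hg : AntitoneOn g (Ici T)) (hBT : 0 ≤ B T) (hT : B T * g T = A T ^ 2) :
    B t * g t < A t ^ 2 := by
  have hF : ∀ x ∈ Ici T, HasDerivWithinAt (fun x => A x ^ 2 - B x * g t)
      (2 * A x * g x - A x * g t) (Ici T) x := by
    intro x hx
    refine (((hA x hx).pow 2).sub ((hB x hx).mul_const (g t))).congr_deriv ?_
    norm_num
  have hmono : StrictMonoOn (fun x => A x ^ 2 - B x * g t) (Icc T t) := by
    refine strictMonoOn_of_deriv_pos (convex_Icc T t)
      (fun x hx => ((hF x hx.1).continuousWithinAt).mono Icc_subset_Ici_self) fun x hx => ?_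
    rw [interior_Icc] at hx
    rw [((hF x hx.1.le).hasDerivAt (Ici_mem_nhds hx.1)).deriv]
    have h1 := hg (mem_Ici.2 hx.1.le) (mem_Ici.2 ht.le) hx.2.le
    have h2 := hApos x hx.1.le
    have h3 := hgpos x hx.1.le
    nlinarith
  have h := hmono (left_mem_Icc.2 ht.le) (right_mem_Icc.2 ht.le) ht
  have h1 := mul_le_mul_of_nonneg_left (hg self_mem_Ici ht.le ht.le) hBT
  simp only at h
  linarith

/-- (Solution of the ODE system.) For `δ > 0` and a smooth positive
gain `c` on `[T, ∞)` with `c(t)e^{−t}` nonincreasing, the functions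
`A(t) = (1/δ)c(T)e^{−T} + ∫_T^t c(s)e^{−s} ds`, `u = −log A` and
`s(t) = (∫_T^t A + (1/δ²)c(T)e^{−T})/A(t)` are `C^∞` on `[T, ∞)` and satisfy, for all
`t > T`: `s′ − s·u′ = 1`, `u″·s − s″ > 0`, `s ≥ 1/δ`, and
`(s + s′²/(u″s − s″))·e^{u−t} = 1/c(t)`. -/
theorem stmt8 (δ T : ℝ) (hδ : 0 < δ) (c : ℝ → ℝ)
    (hc : ContDiffOn ℝ (⊤ : ℕ∞) c (Set.Ici T))
    (hcpos : ∀ t ∈ Set.Ici T, 0 < c t)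
    (hcmono : AntitoneOn (fun t => c t * Real.exp (-t)) (Set.Ici T))
    (A u s : ℝ → ℝ)
    (hA : ∀ t, A t = (1 / δ) * c T * Real.exp (-T) + ∫ x in T..t, c x * Real.exp (-x))
    (hu : ∀ t, u t = -Real.log (A t))
    (hs : ∀ t, s t = ((∫ x in T..t, A x) + (1 / δ ^ 2) * c T * Real.exp (-T)) / A t) :
    ContDiffOn ℝ (⊤ : ℕ∞) u (Set.Ici T) ∧ ContDiffOn ℝ (⊤ : ℕ∞) s (Set.Ici T) ∧
    ∀ t ∈ Set.Ioi T,
      deriv s t - s t * deriv u t = 1 ∧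
      0 < deriv (deriv u) t * s t - deriv (deriv s) t ∧
      1 / δ ≤ s t ∧
      (s t + (deriv s t) ^ 2 / (deriv (deriv u) t * s t - deriv (deriv s) t)) *
        Real.exp (u t - t) = 1 / c t := by
  set g : ℝ → ℝ := fun x => c x * Real.exp (-x) with hgdef
  set B : ℝ → ℝ := fun t => (∫ x in T..t, A x) + (1 / δ ^ 2) * c T * Real.exp (-T) with hBdef
  have hu' : u = fun t => -Real.log (A t) := funext hu
  have hs' : s = fun t => B t / A t := funext hs
  have hgpos : ∀ t ∈ Ici T, 0 < g t := fun t ht => mul_pos (hcpos t ht) (Real.exp_pos _)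
  have hgC : ContDiffOn ℝ (⊤ : ℕ∞) g (Ici T) :=
    hc.mul (Real.contDiff_exp.comp contDiff_neg).contDiffOn
  have hAeq : A = fun t => (1 / δ) * c T * Real.exp (-T) + ∫ x in T..t, g x := funext hA
  have hAC : ContDiffOn ℝ (⊤ : ℕ∞) A (Ici T) := by
    rw [hAeq]
    exact contDiffOn_const.add (contDiffOn_integral_Ici hgC)
  have hBC : ContDiffOn ℝ (⊤ : ℕ∞) B (Ici T) :=
    (contDiffOn_integral_Ici hAC).add contDiffOn_const
  have hAd : ∀ t ∈ Ici T, HasDerivWithinAt A (g t) (Ici T) t := by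
    intro t ht
    rw [hAeq]
    exact (hasDerivWithinAt_integral_Ici hgC.continuousOn ht).const_add _
  have hBd : ∀ t ∈ Ici T, HasDerivWithinAt B (A t) (Ici T) t := fun t ht =>
    (hasDerivWithinAt_integral_Ici hAC.continuousOn ht).add_const _
  have hAT : A T = g T / δ := by
    rw [hA, integral_same, hgdef]
    ring
  have hBT : B T = g T / δ ^ 2 := by
    simp only [hBdef, hgdef, integral_same]
    ring
  have hgT := hgpos T self_mem_Ici
  have hApos : ∀ t ∈ Ici T, 0 < A t := by
    intro t ht
    have h : 0 ≤ ∫ x in T..t, g x := integral_nonneg ht fun x hx => (hgpos x hx.1).le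
    have hcT := hcpos T self_mem_Ici
    rw [hAeq]
    positivity
  have huC : ContDiffOn ℝ (⊤ : ℕ∞) u (Ici T) := by
    rw [hu']
    exact (hAC.log fun t ht => (hApos t ht).ne').neg
  have hsC : ContDiffOn ℝ (⊤ : ℕ∞) s (Ici T) := by
    rw [hs']
    exact hBC.div hAC fun t ht => (hApos t ht).ne'
  have hud : ∀ t ∈ Ioi T, HasDerivAt u (-(g t / A t)) t := by
    intro t ht
    have hm := Ici_mem_nhds (mem_Ioi.1 ht)
    rw [hu']
    exact (((hAd t (Ioi_subset_Ici_self ht)).hasDerivAt hm).log (hApos t (Ioi_subset_Ici_self ht)).ne').neg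
  have hsd : ∀ t ∈ Ioi T, HasDerivAt s (1 + s t * deriv u t) t := by
    intro t ht
    have hm := Ici_mem_nhds (mem_Ioi.1 ht)
    have hA0 := (hApos t (Ioi_subset_Ici_self ht)).ne'
    rw [(hud t ht).deriv, hs']
    refine (((hBd t (Ioi_subset_Ici_self ht)).hasDerivAt hm).div
      ((hAd t (Ioi_subset_Ici_self ht)).hasDerivAt hm) hA0).congr_deriv ?_
    field_simp
    ring
  have hsd_pos : ∀ t ∈ Ioi T, 0 < deriv s t := by
    intro t ht
    have hA0 := hApos t (Ioi_subset_Ici_self ht)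
    have h : B t * g t < A t ^ 2 := by
      refine mul_lt_sq_of_hasDerivWithinAt ht hAd hBd hApos hgpos hcmono ?_ ?_
      · rw [hBT]
        positivity
      · rw [hAT, hBT]
        ring
    rw [(hsd t ht).deriv, (hud t ht).deriv, hs']
    have h2 : 1 + B t / A t * -(g t / A t) = (A t ^ 2 - B t * g t) / A t ^ 2 := by
      field_simp
      ring
    simp only [h2]
    exact div_pos (sub_pos.2 h) (by positivity)
  have hkey : ∀ t ∈ Ioi T,
      deriv (deriv u) t * s t - deriv (deriv s) t = deriv s t * (g t / A t) := by
    intro t ht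
    have hm := Ici_mem_nhds (mem_Ioi.1 ht)
    have hu2 : DifferentiableAt ℝ (deriv u) t := by
      have h : (fun x => -(g x / A x)) =ᶠ[𝓝 t] deriv u :=
        Filter.eventually_of_mem (Ioi_mem_nhds ht) fun x hx => (hud x hx).deriv.symm
      have hgd := (hgC.contDiffAt hm).differentiableAt (by simp)
      have hAd' := (hAC.contDiffAt hm).differentiableAt (by simp)
      exact (hgd.div hAd' (hApos t (Ioi_subset_Ici_self ht)).ne').neg.congr_of_eventuallyEq h.symm
    have hs2 : deriv s =ᶠ[𝓝 t] fun x => 1 + s x * deriv u x :=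
      Filter.eventually_of_mem (Ioi_mem_nhds ht) fun x hx => (hsd x hx).deriv
    have hs3 : HasDerivAt (fun x => 1 + s x * deriv u x)
        (deriv s t * deriv u t + s t * deriv (deriv u) t) t :=
      ((hsd t ht).differentiableAt.hasDerivAt.mul hu2.hasDerivAt).const_add 1
    rw [hs2.deriv_eq, hs3.deriv, (hud t ht).deriv]
    ring
  refine ⟨huC, hsC, fun t ht => ?_⟩
  have hA0 := hApos t (Ioi_subset_Ici_self ht)
  have hg0 := hgpos t (Ioi_subset_Ici_self ht)
  have hs0 := hsd_pos t ht
  refine ⟨by rw [(hsd t ht).deriv]; ring, ?_, ?_, ?_⟩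
  · rw [hkey t ht]
    positivity
  · have hmono : MonotoneOn s (Ici T) := by
      refine monotoneOn_of_deriv_nonneg (convex_Ici T) hsC.continuousOn ?_ ?_ <;>
        rw [interior_Ici]
      · exact fun x hx => (hsd x hx).differentiableAt.differentiableWithinAt
      · exact fun x hx => (hsd_pos x hx).le
    have hsT : s T = 1 / δ := by
      simp only [hs']
      rw [hAT, hBT]
      field_simp
    exact hsT ▸ hmono self_mem_Ici (Ioi_subset_Ici_self ht) (Ioi_subset_Ici_self ht)
  · have hexp : Real.exp (u t - t) = Real.exp (-t) / A t := by
      rw [hu, sub_eq_add_neg, Real.exp_add, Real.exp_neg, Real.exp_log hA0]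
      ring
    have hsum : s t + deriv s t ^ 2 / (deriv s t * (g t / A t)) = A t / g t := by
      have h : deriv s t ^ 2 / (deriv s t * (g t / A t)) = deriv s t * (A t / g t) := by
        field_simp
      rw [h, (hsd t ht).deriv, (hud t ht).deriv]
      field_simp
      ring
    have hc0 := hcpos t (Ioi_subset_Ici_self ht)
    rw [hkey t ht, hsum, hexp, hgdef]
    field_simp
end

section
/- Let T ∈ ℝ and let c : [T, ∞) → (0, ∞) be a function such that t ↦ c(t)e^{−t} is nonincreasing on [T, ∞). Then there exists a sequence of C^∞ functions c_i : ℝ → (0, ∞) (i ∈ ℕ) such that: (1) c_i(t) ≥ c(t) for every t ≥ T and every i; (2) t ↦ c_i(t)e^{−t} is nonincreasing on ℝ for every i; (3) for every t > T, lim_{i→∞} c_i(t)e^{−t} equals the left limit lim_{s→t⁻} c(s)e^{−s}; (4) lim_{i→∞} c_i(T)e^{−T} = c(T)e^{−T}; (5) for every t′ > T, lim_{i→∞} ∫_T^{t′} c_i(s)e^{−s} ds = ∫_T^{t′} c(s)e^{−s} ds. -/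
open Set Filter intervalIntegral
open scoped Topology

/-- A smooth bump supported in the positive interval `(d, 3 * d)`. -/
noncomputable def positiveBump (d : ℝ) (hd : 0 < d) : ContDiffBump (2 * d) :=
  ⟨d / 2, d, by positivity, by linarith⟩

/-- Averages of `g` over points slightly to the left. -/
noncomputable def leftAverage (g : ℝ → ℝ) (d : ℝ) (hd : 0 < d) (t : ℝ) : ℝ :=
  ∫ s, (positiveBump d hd).normed MeasureTheory.volume s * g (t - s)

theorem integrable_leftAverage {g : ℝ → ℝ} (hg : Antitone g) (d : ℝ) (hd : 0 < d) (t : ℝ) :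
    MeasureTheory.Integrable
      (fun s => (positiveBump d hd).normed MeasureTheory.volume s * g (t - s)) := by
  have h := HasCompactSupport.convolutionExists_left (μ := MeasureTheory.volume)
    (ContinuousLinearMap.lsmul ℝ ℝ) ((positiveBump d hd).hasCompactSupport_normed (μ := MeasureTheory.volume))
    ((positiveBump d hd).continuous_normed) hg.locallyIntegrable t
  simpa [MeasureTheory.ConvolutionExistsAt] using h

theorem contDiff_leftAverage {g : ℝ → ℝ} (hg : Antitone g) (d : ℝ) (hd : 0 < d) :
    ContDiff ℝ (⊤ : ℕ∞) (leftAverage g d hd) := by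
  have h := HasCompactSupport.contDiff_convolution_left (μ := MeasureTheory.volume)
    (n := (⊤ : ℕ∞)) (ContinuousLinearMap.lsmul ℝ ℝ)
    ((positiveBump d hd).hasCompactSupport_normed (μ := MeasureTheory.volume))
    ((positiveBump d hd).contDiff_normed) hg.locallyIntegrable
  exact h

theorem antitone_leftAverage {g : ℝ → ℝ} (hg : Antitone g) (d : ℝ) (hd : 0 < d) :
    Antitone (leftAverage g d hd) := by
  intro x y hxy
  refine MeasureTheory.integral_mono (integrable_leftAverage hg d hd y)
    (integrable_leftAverage hg d hd x) fun s => ?_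
  exact mul_le_mul_of_nonneg_left (hg (by linarith)) ((positiveBump d hd).nonneg_normed s)

theorem integral_positiveBump_mul_const (d : ℝ) (hd : 0 < d) (a : ℝ) :
    ∫ s, (positiveBump d hd).normed MeasureTheory.volume s * a = a := by
  rw [MeasureTheory.integral_mul_const, (positiveBump d hd).integral_normed, one_mul]

theorem mem_Ioo_of_positiveBump_ne_zero {d : ℝ} {hd : 0 < d} {s : ℝ}
    (hs : (positiveBump d hd).normed MeasureTheory.volume s ≠ 0) : s ∈ Ioo 0 (3 * d) := by
  have h : s ∈ Function.support ((positiveBump d hd).normed MeasureTheory.volume) := hs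
  rw [ContDiffBump.support_normed_eq, Real.ball_eq_Ioo] at h
  have hr : (positiveBump d hd).rOut = d := rfl
  rw [hr] at h
  exact ⟨by linarith [h.1], by linarith [h.2]⟩

theorem le_leftAverage {g : ℝ → ℝ} (hg : Antitone g) (d : ℝ) (hd : 0 < d) (t a : ℝ)
    (ha : ∀ x < t, a ≤ g x) : a ≤ leftAverage g d hd t := by
  rw [← integral_positiveBump_mul_const d hd a]
  refine MeasureTheory.integral_mono ((positiveBump d hd).integrable_normed.mul_const a)
    (integrable_leftAverage hg d hd t) fun s => ?_
  by_cases hs : (positiveBump d hd).normed MeasureTheory.volume s = 0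
  · simp [hs]
  · exact mul_le_mul_of_nonneg_left
      (ha _ (by linarith [(mem_Ioo_of_positiveBump_ne_zero hs).1]))
      ((positiveBump d hd).nonneg_normed s)

theorem leftAverage_le {g : ℝ → ℝ} (hg : Antitone g) (d : ℝ) (hd : 0 < d) (t : ℝ) :
    leftAverage g d hd t ≤ g (t - 3 * d) := by
  rw [← integral_positiveBump_mul_const d hd (g (t - 3 * d))]
  refine MeasureTheory.integral_mono (integrable_leftAverage hg d hd t)
    ((positiveBump d hd).integrable_normed.mul_const _) fun s => ?_
  by_cases hs : (positiveBump d hd).normed MeasureTheory.volume s = 0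
  · simp [hs]
  · exact mul_le_mul_of_nonneg_left
      (hg (by linarith [(mem_Ioo_of_positiveBump_ne_zero hs).2]))
      ((positiveBump d hd).nonneg_normed s)

theorem tendsto_leftAverage {g : ℝ → ℝ} (hg : Antitone g) {d : ℕ → ℝ} (hd : ∀ i, 0 < d i)
    (hlim : Tendsto d atTop (𝓝 0)) (t : ℝ) :
    Tendsto (fun i => leftAverage g (d i) (hd i) t) atTop (𝓝 (Function.leftLim g t)) := by
  have hleft : Tendsto (fun i => t - 3 * d i) atTop (𝓝[<] t) := by
    refine tendsto_nhdsWithin_iff.2 ⟨?_, Eventually.of_forall fun i => ?_⟩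
    · simpa using tendsto_const_nhds.sub (hlim.const_mul 3)
    · have := hd i
      simp only [mem_Iio]
      linarith
  refine tendsto_of_tendsto_of_tendsto_of_le_of_le tendsto_const_nhds
    ((hg.tendsto_leftLim t).comp hleft) (fun i => ?_) (fun i => leftAverage_le hg _ _ t)
  exact le_leftAverage hg _ _ _ _ fun x hx => hg.leftLim_le hx

theorem tendsto_integral_leftAverage {g : ℝ → ℝ} (hg : Antitone g) {d : ℕ → ℝ}
    (hd : ∀ i, 0 < d i) (hlim : Tendsto d atTop (𝓝 0)) {M : ℝ} (hM : ∀ x, |g x| ≤ M)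
    (a b : ℝ) :
    Tendsto (fun i => ∫ x in a..b, leftAverage g (d i) (hd i) x) atTop
      (𝓝 (∫ x in a..b, g x)) := by
  refine tendsto_integral_filter_of_dominated_convergence (fun _ => M) ?_ ?_ ?_ ?_
  · exact Eventually.of_forall fun i =>
      (contDiff_leftAverage hg (d i) (hd i)).continuous.aestronglyMeasurable
  · refine Eventually.of_forall fun i => Eventually.of_forall fun x _ => ?_
    rw [Real.norm_eq_abs, abs_le]
    exact ⟨le_leftAverage hg _ _ _ _ fun y _ => (abs_le.1 (hM y)).1,
      (leftAverage_le hg _ _ x).trans (abs_le.1 (hM _)).2⟩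
  · exact intervalIntegrable_const
  · filter_upwards [hg.countable_not_continuousAt.ae_notMem MeasureTheory.volume] with x hx _
    have hc : ContinuousAt g x := by simpa using hx
    have hl : Function.leftLim g x = g x := hc.continuousWithinAt.leftLim_eq
    simpa [hl] using tendsto_leftAverage hg hd hlim x

/-- (Smoothing of the gain function.) If `c` is positive on `[T, ∞)`
and `t ↦ c(t)e^{−t}` is nonincreasing on `[T, ∞)`, then there is a sequence of smooth
positive functions `cᵢ : ℝ → (0, ∞)` with `cᵢ ≥ c` on `[T, ∞)`, `cᵢ(t)e^{−t}`
nonincreasing on `ℝ`, `cᵢ(t)e^{−t}` converging to the left limit of `c(s)e^{−s}` at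
every `t > T`, `cᵢ(T)e^{−T} → c(T)e^{−T}`, and
`∫_T^{t′} cᵢ(s)e^{−s} ds → ∫_T^{t′} c(s)e^{−s} ds` for every `t′ > T`. -/
theorem stmt10 (T : ℝ) (c : ℝ → ℝ)
    (hcpos : ∀ t ∈ Set.Ici T, 0 < c t)
    (hcmono : AntitoneOn (fun t => c t * Real.exp (-t)) (Set.Ici T)) :
    ∃ cs : ℕ → ℝ → ℝ,
      (∀ i, ContDiff ℝ (⊤ : ℕ∞) (cs i)) ∧
      (∀ i t, 0 < cs i t) ∧
      (∀ i, ∀ t ∈ Set.Ici T, c t ≤ cs i t) ∧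
      (∀ i, Antitone (fun t => cs i t * Real.exp (-t))) ∧
      (∀ t, T < t →
        Tendsto (fun i => cs i t * Real.exp (-t)) atTop
          (nhds (Function.leftLim (fun x => c x * Real.exp (-x)) t))) ∧
      Tendsto (fun i => cs i T * Real.exp (-T)) atTop (nhds (c T * Real.exp (-T))) ∧
      (∀ t' : ℝ, T < t' →
        Tendsto (fun i => ∫ x in T..t', cs i x * Real.exp (-x)) atTop
          (nhds (∫ x in T..t', c x * Real.exp (-x)))) := by
  set f : ℝ → ℝ := fun t => c t * Real.exp (-t) with hf
  set g : ℝ → ℝ := fun t => f (max t T) with hgdef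
  have hg : Antitone g := fun x y hxy =>
    hcmono (mem_Ici.2 (le_max_right _ _)) (mem_Ici.2 (le_max_right _ _)) (max_le_max_right T hxy)
  have hgpos : ∀ x, 0 < g x := fun x =>
    mul_pos (hcpos _ (mem_Ici.2 (le_max_right _ _))) (Real.exp_pos _)
  have hgf : ∀ x, T ≤ x → g x = f x := fun x hx => by simp only [hgdef, max_eq_left hx]
  have hgM : ∀ x, |g x| ≤ g T := fun x => by
    rw [abs_of_pos (hgpos x)]
    have h : g x = g (max x T) := by simp [hgdef]
    exact h.trans_le (hg (le_max_right _ _))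
  have hd : ∀ i : ℕ, (0 : ℝ) < 1 / ((i : ℝ) + 1) := fun i => by positivity
  have hlim := tendsto_one_div_add_atTop_nhds_zero_nat (𝕜 := ℝ)
  have hcancel : ∀ (i : ℕ) (t : ℝ), leftAverage g _ (hd i) t * Real.exp t * Real.exp (-t) =
      leftAverage g _ (hd i) t := fun i t => by
    rw [mul_assoc, ← Real.exp_add, add_neg_cancel, Real.exp_zero, mul_one]
  have hge : ∀ i t, g t ≤ leftAverage g _ (hd i) t := fun i t =>
    le_leftAverage hg _ _ _ _ fun x hx => hg hx.le
  refine ⟨fun i t => leftAverage g _ (hd i) t * Real.exp t, fun i => ?_, fun i t => ?_,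
    fun i t ht => ?_, fun i => ?_, fun t ht => ?_, ?_, fun t' ht' => ?_⟩
  · exact (contDiff_leftAverage hg _ (hd i)).mul Real.contDiff_exp
  · exact mul_pos ((hgpos t).trans_le (hge i t)) (Real.exp_pos t)
  · have h := mul_le_mul_of_nonneg_right (hge i t) (Real.exp_pos t).le
    rw [hgf t ht] at h
    simpa only [hf, mul_assoc, ← Real.exp_add, neg_add_cancel, Real.exp_zero, mul_one] using h
  · simp only [hcancel]
    exact antitone_leftAverage hg _ (hd i)
  · simp only [hcancel]
    have hev : g =ᶠ[𝓝[<] t] f := by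
      filter_upwards [mem_nhdsWithin_of_mem_nhds (Ioi_mem_nhds ht)] with x hx
      exact hgf x (le_of_lt hx)
    rw [leftLim_eq_of_tendsto
      ((hg.tendsto_leftLim t).congr' hev)]
    exact tendsto_leftAverage hg hd hlim t
  · simp only [hcancel]
    have h : ∀ i, leftAverage g _ (hd i) T = f T := fun i => by
      refine le_antisymm ?_ ((hgf T le_rfl).symm.trans_le (hge i T))
      exact (leftAverage_le hg _ (hd i) T).trans
        ((le_abs_self _).trans ((hgM _).trans_eq (hgf T le_rfl)))
    simp only [h]
    exact tendsto_const_nhds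
  · simp only [hcancel]
    have h : ∫ x in T..t', f x = ∫ x in T..t', g x := by
      refine integral_congr fun x hx => ?_
      rw [uIcc_of_le ht'.le] at hx
      exact (hgf x hx.1).symm
    change Tendsto _ _ (𝓝 (∫ x in T..t', f x))
    rw [h]
    exact tendsto_integral_leftAverage hg hd hlim hgM T t'
end

section
/- Let T ∈ ℝ, let (X, μ) be a measure space, w : X → [0,∞] measurable, Ψ : X → ℝ measurable with Ψ(x) < −T for all x ∈ X, let c : (T, ∞) → (0, ∞) be such that t ↦ c(t)e^{−t} is nonincreasing, and let K ∈ [0, ∞). Assume that ∫_{{−t₁ ≤ Ψ < −t₂}} w·c(−Ψ) dμ = K·∫_{t₂}^{t₁} c(s)e^{−s} ds for all T ≤ t₂ < t₁ < ∞. Then for every measurable a : (T, ∞) → [0, ∞] and all T ≤ t₂ < t₁ ≤ ∞, ∫_{{−t₁ ≤ Ψ < −t₂}} w·a(−Ψ) dμ = K·∫_{t₂}^{t₁} a(s)e^{−s} ds, where for t₁ = ∞ the set {−t₁ ≤ Ψ < −t₂} is understood as {Ψ < −t₂}. -/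
open MeasureTheory Set
open scoped ENNReal

/-- A function that is antitone on an open ray, extended by zero, is measurable. -/
theorem AntitoneOn.measurable_indicator_Ioi {T : ℝ} {f : ℝ → ℝ} (hf : AntitoneOn f (Ioi T)) :
    Measurable ((Ioi T).indicator f) := by
  have hr : Measurable ((Ioi T).domRestrict f) :=
    Antitone.measurable fun x y hxy => hf x.2 y.2 hxy
  refine measurable_of_restrict_of_restrict_compl (s := Ioi T) measurableSet_Ioi ?_ ?_
  · convert hr using 1
    exact funext fun x => indicator_of_mem x.2 f
  · convert measurable_const (a := (0 : ℝ)) using 1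
    exact funext fun x => indicator_of_notMem x.2 f

/-- Two measures that are finite and agree on every bounded interval `(a, b]` with `T < a` agree
on the ray `(T, ∞)`. -/
theorem MeasureTheory.Measure.restrict_Ioi_eq_of_Ioc {T : ℝ} {ρ₁ ρ₂ : Measure ℝ}
    (hfin : ∀ a b, T < a → a < b → ρ₁ (Ioc a b) ≠ ∞)
    (heq : ∀ a b, T < a → a < b → ρ₁ (Ioc a b) = ρ₂ (Ioc a b)) :
    ρ₁.restrict (Ioi T) = ρ₂.restrict (Ioi T) := by
  have hcover : Ioi T = ⋃ n : ℕ, Ioi (T + 1 / ((n : ℝ) + 1)) := by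
    ext x
    simp only [mem_Ioi, mem_iUnion]
    constructor
    · intro hx
      obtain ⟨n, hn⟩ := exists_nat_one_div_lt (sub_pos.2 hx)
      exact ⟨n, by linarith⟩
    · rintro ⟨n, hn⟩
      have : (0 : ℝ) < 1 / ((n : ℝ) + 1) := Nat.one_div_pos_of_nat
      linarith
  rw [hcover, Measure.restrict_iUnion_congr]
  intro n
  have ht : T < T + 1 / ((n : ℝ) + 1) := lt_add_of_pos_right _ Nat.one_div_pos_of_nat
  generalize T + 1 / ((n : ℝ) + 1) = t at ht
  refine Measure.ext_of_Ioc' _ _ (fun a b _ => ?_) (fun a b _ => ?_)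
  all_goals
    simp only [Measure.restrict_apply measurableSet_Ioc, Ioc_inter_Ioi]
    rcases lt_or_ge (max a t) b with hlt | hle
  · exact hfin _ _ (ht.trans_le (le_max_right _ _)) hlt
  · simp [Ioc_eq_empty hle.not_gt]
  · exact heq _ _ (ht.trans_le (le_max_right _ _)) hlt
  · simp [Ioc_eq_empty hle.not_gt]

/-- Change of variables for the pushforward of a measure with density. -/
theorem MeasureTheory.setLIntegral_map_withDensity {X Y : Type*} [MeasurableSpace X]
    [MeasurableSpace Y] (μ : Measure X) {w : X → ℝ≥0∞} (hw : Measurable w) {φ : X → Y}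
    (hφ : Measurable φ) {F : Y → ℝ≥0∞} (hF : Measurable F) {S : Set Y} (hS : MeasurableSet S) :
    ∫⁻ y in S, F y ∂((μ.withDensity w).map φ) = ∫⁻ x in φ ⁻¹' S, w x * F (φ x) ∂μ := by
  rw [setLIntegral_map hS hF hφ]
  exact setLIntegral_withDensity_eq_setLIntegral_mul _ hw (hF.comp hφ) (hφ hS)

/-- If `g · ν` and `K p · λ` agree on `(a, b]` for `T < a < b` (and are finite there), and `g` is
positive and finite on `(T, ∞)`, then `ν` has density `K p / g` on `(T, ∞)`. -/
theorem MeasureTheory.setLIntegral_eq_of_withDensity_Ioc {T : ℝ} {ν : Measure ℝ}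
    {g p q : ℝ → ℝ≥0∞} {K : ℝ≥0∞} (hg : Measurable g) (hp : Measurable p)
    (hg0 : ∀ s ∈ Ioi T, g s ≠ 0) (hgtop : ∀ s ∈ Ioi T, g s ≠ ∞)
    (hq : ∀ s ∈ Ioi T, p s = g s * q s)
    (hfin : ∀ a b, T < a → a < b → K * ∫⁻ s in Ioc a b, p s ≠ ∞)
    (heq : ∀ a b, T < a → a < b → ∫⁻ s in Ioc a b, g s ∂ν = K * ∫⁻ s in Ioc a b, p s)
    {a : ℝ → ℝ≥0∞} (ha : Measurable a) {S : Set ℝ} (hS : MeasurableSet S) (hST : S ⊆ Ioi T) :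
    ∫⁻ s in S, a s ∂ν = K * ∫⁻ s in S, a s * q s := by
  have hρ : (ν.withDensity g).restrict (Ioi T) =
      (K • volume.withDensity p).restrict (Ioi T) := by
    refine Measure.restrict_Ioi_eq_of_Ioc (fun x y hx hxy => ?_) (fun x y hx hxy => ?_)
    · rw [withDensity_apply _ measurableSet_Ioc, heq x y hx hxy]
      exact hfin x y hx hxy
    · simp only [Measure.smul_apply, smul_eq_mul, withDensity_apply _ measurableSet_Ioc]
      exact heq x y hx hxy
  have hρS : (ν.withDensity g).restrict S = (K • volume.withDensity p).restrict S := by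
    rw [← Measure.restrict_restrict_of_subset hST, hρ, Measure.restrict_restrict_of_subset hST]
  have hf : Measurable fun s => a s * (g s)⁻¹ := ha.mul hg.inv
  calc ∫⁻ s in S, a s ∂ν = ∫⁻ s in S, g s * (a s * (g s)⁻¹) ∂ν := by
        refine setLIntegral_congr_fun hS fun s hs => ?_
        rw [mul_left_comm, ENNReal.mul_inv_cancel (hg0 s (hST hs)) (hgtop s (hST hs)), mul_one]
    _ = ∫⁻ s in S, a s * (g s)⁻¹ ∂(ν.withDensity g) :=
        (setLIntegral_withDensity_eq_setLIntegral_mul _ hg hf hS).symm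
    _ = K * ∫⁻ s in S, a s * (g s)⁻¹ ∂(volume.withDensity p) := by
        rw [hρS, Measure.restrict_smul, lintegral_smul_measure, smul_eq_mul]
    _ = K * ∫⁻ s in S, p s * (a s * (g s)⁻¹) := by
        rw [setLIntegral_withDensity_eq_setLIntegral_mul _ hp hf hS]
        rfl
    _ = K * ∫⁻ s in S, a s * q s := by
        congr 1
        refine setLIntegral_congr_fun hS fun s hs => ?_
        rw [hq s (hST hs), show g s * q s * (a s * (g s)⁻¹) = a s * q s * (g s * (g s)⁻¹) by ring,
          ENNReal.mul_inv_cancel (hg0 s (hST hs)) (hgtop s (hST hs)), mul_one]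

/-- (Linearity for every gain.) If the `c`-weighted integrals of `w`
over all sublevel annuli `{−t₁ ≤ Ψ < −t₂}` are proportional (with constant `K`) to
`∫_{t₂}^{t₁} c(s)e^{−s} ds`, then the same proportionality holds for every nonnegative
measurable gain `a`, including the case `t₁ = ∞`. -/
theorem stmt13 {X : Type*} [MeasurableSpace X] (μ : Measure X) (T : ℝ)
    (w : X → ℝ≥0∞) (hw : Measurable w)
    (Ψ : X → ℝ) (hΨ : Measurable Ψ) (hΨT : ∀ x, Ψ x < -T)
    (c : ℝ → ℝ) (hcpos : ∀ t ∈ Set.Ioi T, 0 < c t)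
    (hcmono : AntitoneOn (fun t => c t * Real.exp (-t)) (Set.Ioi T))
    (K : ℝ≥0∞) (hK : K ≠ ⊤)
    (h : ∀ t₂ t₁ : ℝ, T ≤ t₂ → t₂ < t₁ →
      ∫⁻ x in {x | -t₁ ≤ Ψ x ∧ Ψ x < -t₂}, w x * ENNReal.ofReal (c (-Ψ x)) ∂μ =
        K * ∫⁻ s in Set.Ico t₂ t₁, ENNReal.ofReal (c s * Real.exp (-s))) :
    ∀ a : ℝ → ℝ≥0∞, Measurable a → ∀ t₂ t₁ : ℝ, T ≤ t₂ → t₂ < t₁ →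
      (∫⁻ x in {x | -t₁ ≤ Ψ x ∧ Ψ x < -t₂}, w x * a (-Ψ x) ∂μ =
        K * ∫⁻ s in Set.Ico t₂ t₁, a s * ENNReal.ofReal (Real.exp (-s))) ∧
      (∫⁻ x in {x | Ψ x < -t₂}, w x * a (-Ψ x) ∂μ =
        K * ∫⁻ s in Set.Ici t₂, a s * ENNReal.ofReal (Real.exp (-s))) := by
  intro a ha t₂ t₁ ht₂ _
  set P : ℝ → ℝ := (Ioi T).indicator fun t => c t * Real.exp (-t)
  have hPm : Measurable P := hcmono.measurable_indicator_Ioi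
  have hPT : ∀ s ∈ Ioi T, P s = c s * Real.exp (-s) := fun s hs => indicator_of_mem hs _
  have hgT : ∀ s ∈ Ioi T, P s * Real.exp s = c s := fun s hs => by
    rw [hPT s hs, mul_assoc, ← Real.exp_add, neg_add_cancel, Real.exp_zero, mul_one]
  have hgm : Measurable fun s => ENNReal.ofReal (P s * Real.exp s) :=
    (hPm.mul Real.measurable_exp).ennreal_ofReal
  have hφ : Measurable fun x => -Ψ x := hΨ.neg
  have hIoc : ∀ u v : ℝ, (fun x => -Ψ x) ⁻¹' Ioc u v = {x | -v ≤ Ψ x ∧ Ψ x < -u} := by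
    intro u v
    ext x
    simp only [mem_preimage, mem_Ioc, mem_ofPred_eq]
    constructor <;> rintro ⟨h₁, h₂⟩ <;> constructor <;> linarith
  have hIoi : (fun x => -Ψ x) ⁻¹' Ioi t₂ = {x | Ψ x < -t₂} := by
    ext x
    simp only [mem_preimage, mem_Ioi, mem_ofPred_eq]
    exact lt_neg
  have key : ∀ S : Set ℝ, MeasurableSet S → S ⊆ Ioi T →
      ∫⁻ x in (fun x => -Ψ x) ⁻¹' S, w x * a (-Ψ x) ∂μ =
        K * ∫⁻ s in S, a s * ENNReal.ofReal (Real.exp (-s)) := by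
    intro S hS hST
    rw [← setLIntegral_map_withDensity μ hw hφ ha hS]
    refine setLIntegral_eq_of_withDensity_Ioc hgm hPm.ennreal_ofReal (fun s hs => ?_)
      (fun _ _ => ENNReal.ofReal_ne_top) (fun s hs => ?_) (fun u v hu _ => ?_)
      (fun u v hu huv => ?_) ha hS hST
    · rw [hgT s hs]
      exact (ENNReal.ofReal_pos.2 (hcpos s hs)).ne'
    · rw [hgT s hs, hPT s hs, ENNReal.ofReal_mul (hcpos s hs).le]
    · refine ENNReal.mul_ne_top hK (ne_top_of_le_ne_top ?_
        (setLIntegral_mono (g := fun _ => ENNReal.ofReal (c u * Real.exp (-u)))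
          measurable_const fun s hs => ?_))
      · rw [setLIntegral_const]
        exact ENNReal.mul_ne_top ENNReal.ofReal_ne_top measure_Ioc_lt_top.ne
      · rw [hPT s (hu.trans hs.1)]
        exact ENNReal.ofReal_le_ofReal (hcmono hu (hu.trans hs.1) hs.1.le)
    · rw [setLIntegral_map_withDensity μ hw hφ hgm measurableSet_Ioc]
      have hR : ∫⁻ s in Ioc u v, ENNReal.ofReal (P s) =
          ∫⁻ s in Ico u v, ENNReal.ofReal (c s * Real.exp (-s)) := by
        rw [setLIntegral_congr Ico_ae_eq_Ioc]
        exact setLIntegral_congr_fun measurableSet_Ioc fun s hs => by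
          simp only [hPT s (hu.trans hs.1)]
      rw [hIoc, hR, ← h u v hu.le huv]
      refine lintegral_congr fun x => ?_
      rw [hgT _ (mem_Ioi.2 (lt_neg.1 (hΨT x)))]
  constructor
  · rw [← hIoc, key _ measurableSet_Ioc fun s hs => ht₂.trans_lt hs.1,
      setLIntegral_congr Ico_ae_eq_Ioc]
  · rw [← hIoi, key _ measurableSet_Ioi (Ioi_subset_Ioi ht₂), setLIntegral_congr Ioi_ae_eq_Ici]
end

section
/- Let ã : ℝ → (0, ∞) and T ∈ ℝ be such that t ↦ ã(t)eᵗ is strictly increasing and continuous on (T, ∞) and ∫_s^∞ ã(t) dt = ∞ for every s ∈ ℝ. Let (X, μ) be a measure space, g : X → [0,∞] measurable, and let C > 0, r₀ > 0 be such that μ({g ≥ ã(−log r)·r⁻¹}) ≥ C·r for every r ∈ (0, r₀]. Then ∫_X g dμ = ∞. -/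
open MeasureTheory Set
open scoped ENNReal

/-- Layer-cake lower bound over finitely many levels `u 0 ≤ u 1 ≤ ⋯`. -/
theorem sum_mul_measure_superlevel_le_lintegral {X : Type*} [MeasurableSpace X] (μ : Measure X)
    {g : X → ℝ≥0∞} (hg : Measurable g) {u : ℕ → ℝ} (hu0 : 0 ≤ u 0) (hu : Monotone u) (N : ℕ) :
    ENNReal.ofReal (u 0) * μ {x | ENNReal.ofReal (u 0) ≤ g x} +
      ∑ n ∈ Finset.range N, ENNReal.ofReal (u (n + 1) - u n) *
        μ {x | ENNReal.ofReal (u (n + 1)) ≤ g x} ≤ ∫⁻ x, g x ∂μ := by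
  have hA : ∀ c, MeasurableSet {x | c ≤ g x} := fun c => measurableSet_le measurable_const hg
  have hm : ∀ (c : ℝ≥0∞) d, Measurable ({x | d ≤ g x}.indicator fun _ => c) :=
    fun c d => measurable_const.indicator (hA d)
  have total : ∀ M, ENNReal.ofReal (u 0) +
      ∑ n ∈ Finset.range M, ENNReal.ofReal (u (n + 1) - u n) = ENNReal.ofReal (u M) := by
    intro M
    rw [← ENNReal.ofReal_sum_of_nonneg fun n _ => sub_nonneg.2 (hu n.le_succ),
      Finset.sum_range_sub, ← ENNReal.ofReal_add hu0 (sub_nonneg.2 (hu M.zero_le))]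
    congr 1
    ring
  have pointwise : ∀ x, ∀ M, {x | ENNReal.ofReal (u 0) ≤ g x}.indicator
        (fun _ => ENNReal.ofReal (u 0)) x +
      ∑ n ∈ Finset.range M, {x | ENNReal.ofReal (u (n + 1)) ≤ g x}.indicator
        (fun _ => ENNReal.ofReal (u (n + 1) - u n)) x ≤ g x := by
    intro x M
    induction M with
    | zero =>
      simp only [Finset.range_zero, Finset.sum_empty, add_zero]
      exact indicator_apply_le' id fun _ => zero_le
    | succ M ih =>
      by_cases hx : ENNReal.ofReal (u (M + 1)) ≤ g x
      · refine le_trans ?_ hx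
        rw [← total (M + 1)]
        exact add_le_add (indicator_le_self _ _ x)
          (Finset.sum_le_sum fun n _ => indicator_le_self _ _ x)
      · rw [Finset.sum_range_succ, indicator_of_notMem (show x ∉ {x | _ ≤ g x} from hx),
          add_zero]
        exact ih
  calc
    _ = ∫⁻ x, ({x | ENNReal.ofReal (u 0) ≤ g x}.indicator
          (fun _ => ENNReal.ofReal (u 0)) x +
        ∑ n ∈ Finset.range N, {x | ENNReal.ofReal (u (n + 1)) ≤ g x}.indicator
          (fun _ => ENNReal.ofReal (u (n + 1) - u n)) x) ∂μ := by
      rw [lintegral_add_left (hm _ _), lintegral_finsetSum _ fun n _ => hm _ _]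
      simp only [lintegral_indicator_const (hA _)]
    _ ≤ ∫⁻ x, g x ∂μ := lintegral_mono fun x => pointwise x N

/-- Summation by parts against a geometric sequence. -/
theorem mul_sum_mul_geometric_le {u q : ℕ → ℝ} {ρ : ℝ} (hu : ∀ n, 0 ≤ u n) (hq : ∀ n, 0 ≤ q n)
    (hρ : ∀ n, q (n + 1) = ρ * q n) (N : ℕ) :
    (1 - ρ) * ∑ n ∈ Finset.range N, u n * q n ≤
      u 0 * q 0 + ∑ n ∈ Finset.range N, (u (n + 1) - u n) * q (n + 1) := by
  have key : (1 - ρ) * ∑ n ∈ Finset.range N, u n * q n + u N * q N =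
      u 0 * q 0 + ∑ n ∈ Finset.range N, (u (n + 1) - u n) * q (n + 1) := by
    induction N with
    | zero => simp
    | succ N ih =>
      rw [Finset.sum_range_succ, Finset.sum_range_succ, ← add_assoc, ← ih, hρ]
      ring
  linarith [mul_nonneg (hu N) (hq N)]

/-- If `a(t)eᵗ` is increasing on `[s, ∞)`, the integral of `a` is bounded by its Riemann sums. -/
theorem lintegral_Ioi_le_tsum_of_monotoneOn_mul_exp {a : ℝ → ℝ} {s : ℝ} (ha : ∀ t, 0 ≤ a t)
    (hmono : MonotoneOn (fun t => a t * Real.exp t) (Ici s)) :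
    ∫⁻ t in Ioi s, ENNReal.ofReal (a t) ≤
      ENNReal.ofReal (Real.exp 1) * ∑' n : ℕ, ENNReal.ofReal (a (s + n)) := by
  have hsub : Ioi s ⊆ ⋃ n : ℕ, Ico (s + n) (s + n + 1) := by
    intro t ht
    have ht : 0 ≤ t - s := sub_nonneg.2 (le_of_lt ht)
    refine mem_iUnion.2 ⟨⌊t - s⌋₊, ?_, ?_⟩
    · linarith [Nat.floor_le ht]
    · linarith [Nat.lt_floor_add_one (t - s)]
  calc
    _ ≤ ∫⁻ t in ⋃ n : ℕ, Ico (s + n) (s + n + 1), ENNReal.ofReal (a t) :=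
      lintegral_mono_set hsub
    _ ≤ ∑' n : ℕ, ∫⁻ t in Ico (s + n) (s + n + 1), ENNReal.ofReal (a t) :=
      lintegral_iUnion_le _ _
    _ ≤ ∑' n : ℕ, ENNReal.ofReal (Real.exp 1) * ENNReal.ofReal (a (s + (n + 1 : ℕ))) := by
      refine ENNReal.tsum_le_tsum fun n => ?_
      have hn : (0 : ℝ) ≤ n := n.cast_nonneg
      have bound : ∀ t ∈ Ico (s + n) (s + n + 1),
          ENNReal.ofReal (a t) ≤ ENNReal.ofReal (Real.exp 1 * a (s + n + 1)) := by
        intro t ht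
        refine ENNReal.ofReal_le_ofReal ?_
        have h1 : a t * Real.exp t ≤ a (s + n + 1) * Real.exp (s + n + 1) :=
          hmono (show s ≤ t by linarith [ht.1]) (show s ≤ s + n + 1 by linarith) ht.2.le
        have h2 : Real.exp (s + n + 1) ≤ Real.exp 1 * Real.exp t := by
          rw [← Real.exp_add]
          exact Real.exp_le_exp.2 (by linarith [ht.1])
        refine le_of_mul_le_mul_right ?_ (Real.exp_pos t)
        calc
          _ ≤ _ := h1
          _ ≤ _ := mul_le_mul_of_nonneg_left h2 (ha _)
          _ = _ := by ring
      refine (setLIntegral_mono' measurableSet_Ico bound).trans_eq ?_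
      rw [setLIntegral_const, Real.volume_Ico, add_sub_cancel_left, ENNReal.ofReal_one, mul_one,
        ENNReal.ofReal_mul (Real.exp_pos 1).le]
      push_cast
      rw [add_assoc]
    _ ≤ ENNReal.ofReal (Real.exp 1) * ∑' n : ℕ, ENNReal.ofReal (a (s + n)) := by
      rw [ENNReal.tsum_mul_left]
      exact mul_le_mul' le_rfl (ENNReal.tsum_comp_le_tsum_of_injective (add_left_injective 1)
        fun n : ℕ => ENNReal.ofReal (a (s + n)))

/-- Let `a'` (the `ã` of the paper) be positive with `a'(t)eᵗ`
strictly increasing and continuous on `(T, ∞)` and `a'` not integrable near `+∞`.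
If `μ({g ≥ a'(−log r)·r⁻¹}) ≥ C·r` for every `r ∈ (0, r₀]`, then `∫ g dμ = ∞`. -/
theorem stmt14 (a' : ℝ → ℝ) (T : ℝ) (hpos : ∀ t, 0 < a' t)
    (hmono : StrictMonoOn (fun t => a' t * Real.exp t) (Set.Ioi T))
    (hcont : ContinuousOn (fun t => a' t * Real.exp t) (Set.Ioi T))
    (hint : ∀ s : ℝ, ∫⁻ t in Set.Ioi s, ENNReal.ofReal (a' t) = ⊤)
    {X : Type*} [MeasurableSpace X] (μ : Measure X)
    (g : X → ℝ≥0∞) (hg : Measurable g)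
    (C r₀ : ℝ) (hC : 0 < C) (hr₀ : 0 < r₀)
    (h : ∀ r : ℝ, 0 < r → r ≤ r₀ →
      ENNReal.ofReal (C * r) ≤ μ {x | ENNReal.ofReal (a' (-Real.log r) * r⁻¹) ≤ g x}) :
    ∫⁻ x, g x ∂μ = ⊤ := by
  set s := max (T + 1) (-Real.log r₀)
  have hsT : T < s := (lt_add_one T).trans_le (le_max_left _ _)
  have hmono' : MonotoneOn (fun t => a' t * Real.exp t) (Ici s) :=
    hmono.monotoneOn.mono fun t ht => hsT.trans_le ht
  have hlevel : ∀ t, s ≤ t → ENNReal.ofReal (C * Real.exp (-t)) ≤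
      μ {x | ENNReal.ofReal (a' t * Real.exp t) ≤ g x} := by
    intro t ht
    have hr : Real.exp (-t) ≤ r₀ := by
      rw [← Real.le_log_iff_exp_le hr₀]
      linarith [(le_max_right (T + 1) (-Real.log r₀)).trans ht]
    simpa [Real.exp_neg] using h (Real.exp (-t)) (Real.exp_pos _) hr
  let u : ℕ → ℝ := fun n => a' (s + n) * Real.exp (s + n)
  let q : ℕ → ℝ := fun n => Real.exp (-(s + n))
  have hu0 : ∀ n, 0 ≤ u n := fun n => (mul_pos (hpos _) (Real.exp_pos _)).le
  have hq0 : ∀ n, 0 ≤ q n := fun n => (Real.exp_pos _).le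
  have hsn : ∀ n : ℕ, s ≤ s + n := fun n => le_add_of_nonneg_right n.cast_nonneg
  have hu : Monotone u := fun m n hmn =>
    hmono' (hsn m) (hsn n) (by gcongr)
  have hq : ∀ n, q (n + 1) = Real.exp (-1) * q n := by
    intro n
    simp only [q, ← Real.exp_add]
    push_cast
    ring_nf
  have huq : ∀ n : ℕ, u n * q n = a' (s + n) := by
    intro n
    simp only [u, q, mul_assoc, ← Real.exp_add, add_neg_cancel, Real.exp_zero, mul_one]
  have hD : 0 < C * (1 - Real.exp (-1)) :=
    mul_pos hC (sub_pos.2 (Real.exp_lt_one_iff.2 (by norm_num)))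
  have hpartial : ∀ N, ENNReal.ofReal (C * (1 - Real.exp (-1))) *
      ∑ n ∈ Finset.range N, ENNReal.ofReal (a' (s + n)) ≤ ∫⁻ x, g x ∂μ := by
    intro N
    have hw : ∀ n, 0 ≤ u (n + 1) - u n := fun n => sub_nonneg.2 (hu n.le_succ)
    calc
      _ = ENNReal.ofReal (C * ((1 - Real.exp (-1)) * ∑ n ∈ Finset.range N, u n * q n)) := by
        rw [← ENNReal.ofReal_sum_of_nonneg fun n _ => (hpos _).le, ← ENNReal.ofReal_mul hD.le,
          mul_assoc]
        simp only [huq]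
      _ ≤ ENNReal.ofReal (C * (u 0 * q 0 +
          ∑ n ∈ Finset.range N, (u (n + 1) - u n) * q (n + 1))) :=
        ENNReal.ofReal_le_ofReal
          (mul_le_mul_of_nonneg_left (mul_sum_mul_geometric_le hu0 hq0 hq N) hC.le)
      _ = ENNReal.ofReal (u 0) * ENNReal.ofReal (C * q 0) + ∑ n ∈ Finset.range N,
          ENNReal.ofReal (u (n + 1) - u n) * ENNReal.ofReal (C * q (n + 1)) := by
        simp only [← ENNReal.ofReal_mul (hu0 _), ← ENNReal.ofReal_mul (hw _)]
        have hterm : ∀ n, 0 ≤ (u (n + 1) - u n) * (C * q (n + 1)) :=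
          fun n => mul_nonneg (hw n) (mul_nonneg hC.le (hq0 _))
        rw [← ENNReal.ofReal_sum_of_nonneg fun n _ => hterm n,
          ← ENNReal.ofReal_add (mul_nonneg (hu0 0) (mul_nonneg hC.le (hq0 0)))
            (Finset.sum_nonneg fun n _ => hterm n), mul_add, Finset.mul_sum]
        simp only [mul_left_comm C]
      _ ≤ ENNReal.ofReal (u 0) * μ {x | ENNReal.ofReal (u 0) ≤ g x} +
          ∑ n ∈ Finset.range N, ENNReal.ofReal (u (n + 1) - u n) *
            μ {x | ENNReal.ofReal (u (n + 1)) ≤ g x} := by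
        gcongr with n
        · exact hlevel _ (hsn 0)
        · exact hlevel _ (hsn (n + 1))
      _ ≤ ∫⁻ x, g x ∂μ := sum_mul_measure_superlevel_le_lintegral μ hg (hu0 0) hu N
  have htsum : ∑' n : ℕ, ENNReal.ofReal (a' (s + n)) = ⊤ := by
    have hle := lintegral_Ioi_le_tsum_of_monotoneOn_mul_exp (fun t => (hpos t).le) hmono'
    rw [hint s, top_le_iff] at hle
    by_contra hne
    exact ENNReal.mul_ne_top ENNReal.ofReal_ne_top hne hle
  rw [← top_le_iff]
  calc
    _ = ENNReal.ofReal (C * (1 - Real.exp (-1))) * ∑' n : ℕ, ENNReal.ofReal (a' (s + n)) := by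
      rw [htsum, ENNReal.mul_top (ENNReal.ofReal_pos.2 hD).ne']
    _ ≤ ∫⁻ x, g x ∂μ := by
      rw [ENNReal.tsum_eq_iSup_nat, ENNReal.mul_iSup]
      exact iSup_le hpartial
end
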